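/- arXiv:2408.00911 — 2 statements merged into one kernel-verified Lean document; each statement's English description precedes it below -/
import Mathlib

section
/- Let D_S and D_Z be nonnegative real-valued random variables on a probability space (modeling the spatial distance d_S(s, s') and the latent distance d_Z(z, z') of a random pair). Let λ > 0, let 0 < δ < ε < 1, and let 0 < M₁ ≤ M₂ be such that ℙ( M₁ ≤ D_S ≤ M₂ ) ≥ 1 − δ. Suppose the distortion loss ℒ := 𝔼[ |D_Z − λ·D_S| ] is finite, set C := ℒ / (ε − δ), and assume λ·M₁ > C. Then, with λ' := λ − C/M₁ > 0 and L := (λ·M₁ + C) / (λ·M₁ − C), we have ℙ( λ'·D_S ≤ D_Z ≤ L·λ'·D_S ) ≥ 1 − ε. In particular, the distortion constant L of the model satisfies a bound proportional to the distortion loss ℒ. -/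
open MeasureTheory

/-- **Theorem 1 (distortion loss bounds the distortion constant), random-variable form.**
If `D_S, D_Z` are nonnegative real random variables, `λ > 0`, `0 < δ < ε < 1`,
`0 < M₁ ≤ M₂` with `ℙ(M₁ ≤ D_S ≤ M₂) ≥ 1 - δ`, the distortion loss
`ℒ = 𝔼|D_Z - λ D_S|` is finite, `C = ℒ/(ε - δ)` and `λ M₁ > C`, then with
`λ' = λ - C/M₁ > 0` and `L = (λ M₁ + C)/(λ M₁ - C)` we have
`ℙ(λ' D_S ≤ D_Z ≤ L λ' D_S) ≥ 1 - ε`. -/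
theorem stmt_3 {Ω : Type*} [MeasurableSpace Ω] (μ : Measure Ω) [IsProbabilityMeasure μ]
    (DS DZ : Ω → ℝ) (hDSmeas : Measurable DS) (hDZmeas : Measurable DZ)
    (hDSnn : ∀ ω, 0 ≤ DS ω) (hDZnn : ∀ ω, 0 ≤ DZ ω)
    (lam δ ε M₁ M₂ : ℝ) (hlam : 0 < lam)
    (hδ0 : 0 < δ) (hδε : δ < ε) (hε1 : ε < 1)
    (hM₁ : 0 < M₁) (hM₁₂ : M₁ ≤ M₂)
    (hA : ENNReal.ofReal (1 - δ) ≤ μ {ω | M₁ ≤ DS ω ∧ DS ω ≤ M₂})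
    (hInt : Integrable (fun ω => |DZ ω - lam * DS ω|) μ)
    (Ldis C lam' L : ℝ)
    (hLdis : Ldis = ∫ ω, |DZ ω - lam * DS ω| ∂μ)
    (hC : C = Ldis / (ε - δ))
    (hCM : C < lam * M₁)
    (hlam' : lam' = lam - C / M₁)
    (hL : L = (lam * M₁ + C) / (lam * M₁ - C)) :
    0 < lam' ∧
    ENNReal.ofReal (1 - ε) ≤
      μ {ω | lam' * DS ω ≤ DZ ω ∧ DZ ω ≤ L * (lam' * DS ω)} := by
  have hed : 0 < ε - δ := sub_pos.2 hδε
  have hL0 : 0 ≤ Ldis := hLdis ▸ integral_nonneg (fun ω => abs_nonneg _)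
  have hC0 : 0 ≤ C := hC ▸ div_nonneg hL0 hed.le
  have hCL : C * (ε - δ) = Ldis := by rw [hC]; field_simp
  have hpos : 0 < lam * M₁ - C := sub_pos.2 hCM
  have hlamM : lam' = (lam * M₁ - C) / M₁ := by rw [hlam']; field_simp
  have hLl : L * lam' = lam + C / M₁ := by
    rw [hL, hlamM]; field_simp
  refine ⟨hlamM ▸ div_pos hpos hM₁, ?_⟩
  have hB : μ.real {ω | C < |DZ ω - lam * DS ω|} ≤ ε - δ := by
    rcases hC0.eq_or_lt with h0 | h0
    · have hz : ∫ ω, |DZ ω - lam * DS ω| ∂μ = 0 := by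
        rw [← hLdis, ← hCL, ← h0, zero_mul]
      have hae := (integral_eq_zero_iff_of_nonneg (fun ω => abs_nonneg _) hInt).1 hz
      have hm : μ {ω | C < |DZ ω - lam * DS ω|} = 0 := by
        rw [measure_eq_zero_iff_ae_notMem]
        filter_upwards [hae] with ω hω
        have hω2 : |DZ ω - lam * DS ω| = 0 := hω
        simp only [Set.mem_setOf_eq, hω2, ← h0, lt_irrefl, not_false_eq_true]
      rw [measureReal_def, hm]
      simpa using hδε.le
    · have hmk := mul_meas_ge_le_integral_of_nonneg
        (Filter.Eventually.of_forall (fun ω => abs_nonneg _)) hInt C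
      rw [← hLdis, ← hCL] at hmk
      have h1 := le_of_mul_le_mul_left hmk h0
      refine le_trans (measureReal_mono ?_) h1
      intro ω hω
      exact le_of_lt (Set.mem_setOf_eq ▸ hω)
  have hA2 : 1 - δ ≤ μ.real {ω | M₁ ≤ DS ω ∧ DS ω ≤ M₂} :=
    (ENNReal.ofReal_le_iff_le_toReal (measure_ne_top _ _)).1 hA
  refine (ENNReal.ofReal_le_iff_le_toReal (measure_ne_top _ _)).2 ?_
  change 1 - ε ≤ μ.real _
  have hsub : {ω | M₁ ≤ DS ω ∧ DS ω ≤ M₂} ⊆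
      {ω | lam' * DS ω ≤ DZ ω ∧ DZ ω ≤ L * (lam' * DS ω)} ∪
        {ω | C < |DZ ω - lam * DS ω|} := by
    rintro ω ⟨h1, _⟩
    by_cases h : C < |DZ ω - lam * DS ω|
    · exact Or.inr h
    · left
      have h2 := abs_le.1 (not_lt.1 h)
      have h3 : C ≤ C / M₁ * DS ω := by
        calc C = C / M₁ * M₁ := by field_simp
          _ ≤ C / M₁ * DS ω := by gcongr
      refine ⟨?_, ?_⟩
      · rw [hlam', sub_mul]; linarith [h2.1]
      · rw [← mul_assoc, hLl, add_mul]; linarith [h2.2]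
  have h4 := measureReal_mono (μ := μ) hsub
  have h5 := h4.trans (measureReal_union_le _ _)
  linarith
end

section
/- Let S and Z be metric spaces, and let s, s' : Ω → S and z, z' : Ω → Z be measurable random elements on a probability space Ω. Let λ > 0, let 0 < δ < ε < 1, and let 0 < M₁ ≤ M₂ be such that ℙ( M₁ ≤ d_S(s, s') ≤ M₂ ) ≥ 1 − δ. Suppose ℒ := 𝔼[ |d_Z(z, z') − λ·d_S(s, s')| ] is finite, set C := ℒ / (ε − δ), and assume λ·M₁ > C. Then, with λ' := λ − C/M₁ and L := (λ·M₁ + C) / (λ·M₁ − C), we have ℙ( λ'·d_S(s, s') ≤ d_Z(z, z') ≤ L·λ'·d_S(s, s') ) ≥ 1 − ε. -/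
open MeasureTheory

/-- **Theorem 1, metric-space formulation.**
For measurable random elements `s, s' : Ω → S` and `z, z' : Ω → Z` of metric spaces,
`λ > 0`, `0 < δ < ε < 1`, `0 < M₁ ≤ M₂` with `ℙ(M₁ ≤ d_S(s,s') ≤ M₂) ≥ 1 - δ`,
finite distortion loss `ℒ = 𝔼|d_Z(z,z') - λ d_S(s,s')|`, `C = ℒ/(ε-δ)` and `λ M₁ > C`,
with `λ' = λ - C/M₁` and `L = (λ M₁ + C)/(λ M₁ - C)` we have
`ℙ(λ' d_S(s,s') ≤ d_Z(z,z') ≤ L λ' d_S(s,s')) ≥ 1 - ε`. -/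
theorem stmt_4 {Ω S Z : Type*} [MeasurableSpace Ω]
    [MetricSpace S] [MeasurableSpace S] [BorelSpace S]
    [MetricSpace Z] [MeasurableSpace Z] [BorelSpace Z]
    (μ : Measure Ω) [IsProbabilityMeasure μ]
    (s s' : Ω → S) (z z' : Ω → Z)
    (hs : Measurable s) (hs' : Measurable s') (hz : Measurable z) (hz' : Measurable z')
    (lam δ ε M₁ M₂ : ℝ) (hlam : 0 < lam)
    (hδ0 : 0 < δ) (hδε : δ < ε) (hε1 : ε < 1)
    (hM₁ : 0 < M₁) (hM₁₂ : M₁ ≤ M₂)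
    (hA : ENNReal.ofReal (1 - δ) ≤ μ {ω | M₁ ≤ dist (s ω) (s' ω) ∧ dist (s ω) (s' ω) ≤ M₂})
    (hInt : Integrable (fun ω => |dist (z ω) (z' ω) - lam * dist (s ω) (s' ω)|) μ)
    (Ldis C lam' L : ℝ)
    (hLdis : Ldis = ∫ ω, |dist (z ω) (z' ω) - lam * dist (s ω) (s' ω)| ∂μ)
    (hC : C = Ldis / (ε - δ))
    (hCM : C < lam * M₁)
    (hlam' : lam' = lam - C / M₁)
    (hL : L = (lam * M₁ + C) / (lam * M₁ - C)) :
    ENNReal.ofReal (1 - ε) ≤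
      μ {ω | lam' * dist (s ω) (s' ω) ≤ dist (z ω) (z' ω) ∧
             dist (z ω) (z' ω) ≤ L * (lam' * dist (s ω) (s' ω))} := by
  have hed : 0 < ε - δ := sub_pos.mpr hδε
  have hL0 : 0 ≤ Ldis := by
    rw [hLdis]; exact integral_nonneg fun ω => abs_nonneg _
  have hC0 : 0 ≤ C := by rw [hC]; exact div_nonneg hL0 hed.le
  have hLC : Ldis = C * (ε - δ) := by rw [hC]; field_simp
  have hB : μ {ω | C < |dist (z ω) (z' ω) - lam * dist (s ω) (s' ω)|}
      ≤ ENNReal.ofReal (ε - δ) := by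
    rcases hC0.eq_or_lt with h0 | hpos
    · have hz0 : ∫ ω, |dist (z ω) (z' ω) - lam * dist (s ω) (s' ω)| ∂μ = 0 := by
        rw [← hLdis, hLC, ← h0, zero_mul]
      have hae := (integral_eq_zero_iff_of_nonneg (fun ω => abs_nonneg _) hInt).1 hz0
      have hnull : μ {ω | C < |dist (z ω) (z' ω) - lam * dist (s ω) (s' ω)|} = 0 := by
        refine measure_mono_null ?_ (ae_iff.1 hae)
        intro ω hω h
        simp only [Set.mem_ofPred_eq] at hω
        simp only [Pi.zero_apply] at h
        linarith
      rw [hnull]; exact zero_le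
    · have hm := mul_meas_ge_le_integral_of_nonneg
        (Filter.Eventually.of_forall fun ω => abs_nonneg _) hInt C
      rw [← hLdis, hLC] at hm
      have hm' := le_of_mul_le_mul_left hm hpos
      refine (measure_mono (fun ω hω => ?_)).trans
        ((ENNReal.le_ofReal_iff_toReal_le (measure_ne_top μ _) hed.le).2 hm')
      simp only [Set.mem_ofPred_eq] at hω ⊢
      exact hω.le
  have hsub : {ω | M₁ ≤ dist (s ω) (s' ω) ∧ dist (s ω) (s' ω) ≤ M₂} ⊆
      {ω | lam' * dist (s ω) (s' ω) ≤ dist (z ω) (z' ω) ∧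
             dist (z ω) (z' ω) ≤ L * (lam' * dist (s ω) (s' ω))} ∪
      {ω | C < |dist (z ω) (z' ω) - lam * dist (s ω) (s' ω)|} := by
    rintro ω ⟨h1, -⟩
    by_cases hc : C < |dist (z ω) (z' ω) - lam * dist (s ω) (s' ω)|
    · exact Or.inr hc
    left
    obtain ⟨ha, hb⟩ := abs_le.1 (not_lt.1 hc)
    have hCd : C ≤ C / M₁ * dist (s ω) (s' ω) := by
      rw [div_mul_eq_mul_div, le_div_iff₀ hM₁]
      exact mul_le_mul_of_nonneg_left h1 hC0
    have hne : lam * M₁ - C ≠ 0 := (sub_pos.2 hCM).ne'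
    have hLl : L * lam' = lam + C / M₁ := by
      rw [hL, hlam']; field_simp
    constructor
    · rw [hlam']; linarith
    · rw [← mul_assoc, hLl]; linarith
  have hfin := (hA.trans (measure_mono hsub)).trans
    ((measure_union_le _ _).trans (add_le_add le_rfl hB))
  have hsplit : ENNReal.ofReal (1 - δ) = ENNReal.ofReal (1 - ε) + ENNReal.ofReal (ε - δ) := by
    rw [← ENNReal.ofReal_add (by linarith) hed.le]; congr 1; ring
  rw [hsplit] at hfin
  exact (ENNReal.add_le_add_iff_right ENNReal.ofReal_ne_top).1 hfin
end
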